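/- Let (W,S) and (W',S') be Coxeter systems and suppose R' is a twist of a Coxeter generating set R ⊆ S^W. Then R ⊆ (R')^W and R'^W = R^W; moreover R is a twist of R' (twisting is a symmetric relation: R' = T_{(J,K)}(R) for an R-admissible pair (J,K) implies R = T_{(J',K')}(R') for an R'-admissible pair (J',K')). -/

import Mathlib

section

variable {W : Type*} [Group W]

/-- A subset `R` of a group `W` is a Coxeter generating set if there is a Coxeter system on `W`
whose simple reflections are exactly the elements of `R`. -/
def IsCoxeterGenSet (R : Set W) : Prop :=
  ∃ (M : CoxeterMatrix R) (cs : CoxeterSystem M W), ∀ r : R, cs.simple r = (r : W)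

/-- The word length of `w` with respect to the generating set `R`. -/
noncomputable def wordLength (R : Set W) (w : W) : ℕ :=
  sInf {n | ∃ l : List W, (∀ x ∈ l, x ∈ R) ∧ l.length = n ∧ l.prod = w}

/-- `ρ` is the longest element of `⟨J⟩` with respect to the generating set `R`. -/
def IsLongestIn (R : Set W) (J : Set W) (ρ : W) : Prop :=
  ρ ∈ Subgroup.closure J ∧ ∀ x ∈ Subgroup.closure J, wordLength R x ≤ wordLength R ρ

/-- `J^⊥`: the elements of `R` commuting with (i.e. having product of order `2` with)
every element of `J`. -/
def perpSet (R J : Set W) : Set W :=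
  {k ∈ R | ∀ j ∈ J, orderOf (k * j) = 2}

/-- `(J, K)` is an `R`-admissible pair: `J, K ⊆ R`, `⟨J⟩` is finite,
`K ∩ (J ∪ J^⊥) = ∅`, and `o(k l) = ∞` for all `k ∈ K`, `l ∈ L := R \ (J ∪ J^⊥ ∪ K)`
(order `0` encodes `∞`). -/
def IsAdmissiblePair (R J K : Set W) : Prop :=
  J ⊆ R ∧ K ⊆ R ∧
  ((Subgroup.closure J : Subgroup W) : Set W).Finite ∧
  K ∩ (J ∪ perpSet R J) = ∅ ∧
  ∀ k ∈ K, ∀ l ∈ R \ (J ∪ perpSet R J ∪ K), orderOf (k * l) = 0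

/-- The twist `T_{(J,K)}(R) = J ∪ J^⊥ ∪ K ∪ {ρ_J l ρ_J : l ∈ L}`. -/
def twistSet (R J K : Set W) (ρ : W) : Set W :=
  J ∪ perpSet R J ∪ K ∪ (fun l => ρ * l * ρ⁻¹) '' (R \ (J ∪ perpSet R J ∪ K))

/-- `R'` is a twist of `R`. -/
def IsTwistOf (R' R : Set W) : Prop :=
  ∃ J K ρ, IsAdmissiblePair R J K ∧ IsLongestIn R J ρ ∧ R' = twistSet R J K ρ

/-- The set `A^W` of all `W`-conjugates of elements of `A`. -/
def conjSet (A : Set W) : Set W :=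
  {x | ∃ w : W, ∃ a ∈ A, x = w * a * w⁻¹}

noncomputable def twDel (u s : W) : ZMod 2 := open Classical in if u = s then 1 else 0

theorem twDel_self (u : W) : twDel u u = 1 := by simp [twDel]

theorem twDel_ne {u s : W} (h : u ≠ s) : twDel u s = 0 := by simp [twDel, h]

theorem twDel_conj (g u s : W) : twDel (g * u * g⁻¹) s = twDel u (g⁻¹ * s * g) := by
  have : (g * u * g⁻¹ = s) ↔ (u = g⁻¹ * s * g) := by
    constructor
    · rintro rfl; group
    · rintro rfl; group
  classical
  unfold twDel
  by_cases hc : u = g⁻¹ * s * g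
  · rw [if_pos hc, if_pos (this.2 hc)]
  · rw [if_neg hc, if_neg (fun hh => hc (this.1 hh))]

theorem z2_double (a : ZMod 2) : a + a = 0 := CharTwo.add_self_eq_zero a

theorem z2_cases (a : ZMod 2) : a = 0 ∨ a = 1 := by revert a; decide

noncomputable def twEta (s : W) : Equiv.Perm (W × ZMod 2) where
  toFun x := (s * x.1 * s⁻¹, x.2 + twDel x.1 s)
  invFun x := (s⁻¹ * x.1 * s, x.2 - twDel (s⁻¹ * x.1 * s) s)
  left_inv x := by
    ext
    · simp; group
    · have : s⁻¹ * (s * x.1 * s⁻¹) * s = x.1 := by group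
      simp only [this]; ring
  right_inv x := by
    ext
    · simp; group
    · simp

theorem twEta_apply (s u : W) (e : ZMod 2) : twEta s (u, e) = (s * u * s⁻¹, e + twDel u s) := rfl

theorem twEta_pow (s t : W) (hs : s * s = 1) (ht : t * t = 1) (m : ℕ) (u : W) (e : ZMod 2) :
    ((twEta s * twEta t) ^ m) (u, e) =
      ((s * t) ^ m * u * ((s * t) ^ m)⁻¹,
        e + ∑ k ∈ Finset.range (2 * m), twDel u (t * (s * t) ^ k)) := by
  have hsi : s⁻¹ = s := inv_eq_of_mul_eq_one_left hs
  have hti : t⁻¹ = t := inv_eq_of_mul_eq_one_left ht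
  have hp : ∀ m : ℕ, ((s * t) ^ m)⁻¹ * t = t * (s * t) ^ m := by
    intro m
    induction m with
    | zero => simp
    | succ m ih =>
      rw [pow_succ, mul_inv_rev, mul_assoc, ih, mul_inv_rev, hsi, hti, ← pow_succ, pow_succ']
      simp only [mul_assoc]
  induction m with
  | zero => simp
  | succ m ih =>
    rw [pow_succ', Equiv.Perm.mul_apply, ih, Equiv.Perm.mul_apply, twEta_apply, twEta_apply]
    have h2 : 2 * (m + 1) = 2 * m + 1 + 1 := by ring
    rw [h2, Finset.sum_range_succ, Finset.sum_range_succ]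
    refine Prod.ext ?_ ?_
    · simp only [pow_succ', mul_inv_rev, mul_assoc]
    · have e1 : twDel ((s * t) ^ m * u * ((s * t) ^ m)⁻¹) t = twDel u (t * (s * t) ^ (2 * m)) := by
        rw [twDel_conj, hp, two_mul, pow_add, mul_assoc]
      have e2 : twDel (t * ((s * t) ^ m * u * ((s * t) ^ m)⁻¹) * t⁻¹) s
          = twDel u (t * (s * t) ^ (2 * m + 1)) := by
        rw [twDel_conj, twDel_conj]
        congr 1
        rw [hti]
        calc ((s * t) ^ m)⁻¹ * (t * s * t) * (s * t) ^ m
            = (((s * t) ^ m)⁻¹ * t) * ((s * t) * (s * t) ^ m) := by simp only [mul_assoc]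
          _ = t * (s * t) ^ (2 * m + 1) := by
            rw [hp, mul_assoc, ← pow_succ', ← pow_add]
            congr 2; ring
      simp only [e1, e2]
      ring

structure TwEX (R : Set W) (f : W →* Equiv.Perm (W × ZMod 2)) : Prop where
  invol : ∀ r ∈ R, r * r = 1
  gen : Subgroup.closure R = ⊤
  act : ∀ r ∈ R, f r = twEta r

theorem twEX_of_coxeter {R : Set W} (h : IsCoxeterGenSet R) : ∃ f, TwEX R f := by
  obtain ⟨M, cs, hcs⟩ := h
  have hinv : ∀ r ∈ R, r * r = 1 := fun r hr => by
    have := cs.simple_mul_simple_self ⟨r, hr⟩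
    rwa [hcs] at this
  have hl : M.IsLiftable (fun r : R => twEta (r : W)) := by
    intro i j
    ext1 x
    obtain ⟨u, e⟩ := x
    have hpow : ((i : W) * (j : W)) ^ M i j = 1 := by
      have := cs.simple_mul_simple_pow i j
      rwa [hcs, hcs] at this
    rw [twEta_pow _ _ (hinv _ i.2) (hinv _ j.2), hpow, two_mul, Finset.sum_range_add]
    simp only [pow_add, hpow, one_mul, z2_double]
    simp
  refine ⟨cs.lift ⟨_, hl⟩, hinv, ?_, ?_⟩
  · rw [← cs.subgroup_closure_range_simple]
    congr 1
    ext x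
    constructor
    · intro hx; exact ⟨⟨x, hx⟩, hcs _⟩
    · rintro ⟨r, rfl⟩; rw [hcs]; exact r.2
  · intro r hr
    have := cs.lift_apply_simple hl ⟨r, hr⟩
    rwa [hcs] at this

theorem list_of_mem_closure {I : Set W} (hI : ∀ r ∈ I, r * r = 1) {w : W}
    (hw : w ∈ Subgroup.closure I) : ∃ l : List W, (∀ x ∈ l, x ∈ I) ∧ l.prod = w := by
  induction hw using Subgroup.closure_induction with
  | mem x hx => exact ⟨[x], by simpa using hx, by simp⟩
  | one => exact ⟨[], by simp, rfl⟩
  | mul x y _ _ hx hy =>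
    obtain ⟨l, h1, rfl⟩ := hx
    obtain ⟨l', h1', rfl⟩ := hy
    refine ⟨l ++ l', ?_, by simp⟩
    intro x hx
    rcases List.mem_append.1 hx with h | h
    · exact h1 x h
    · exact h1' x h
  | inv x _ hx =>
    obtain ⟨l, h1, rfl⟩ := hx
    refine ⟨l.reverse, by simpa using h1, ?_⟩
    rw [List.prod_inv_reverse]
    congr 2
    conv_lhs => rw [← List.map_id l]
    apply List.map_congr_left
    intro a ha
    exact (inv_eq_of_mul_eq_one_left (hI a (h1 a ha))).symm

theorem tw_list_prod_mem {I : Set W} {l : List W} (hl : ∀ x ∈ l, x ∈ I) :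
    l.prod ∈ Subgroup.closure I :=
  Subgroup.list_prod_mem _ fun x hx => Subgroup.subset_closure (hl x hx)

theorem exists_min_list {I : Set W} (hI : ∀ r ∈ I, r * r = 1) {w : W}
    (hw : w ∈ Subgroup.closure I) : ∃ l : List W, (∀ x ∈ l, x ∈ I) ∧ l.prod = w ∧
      ∀ l' : List W, (∀ x ∈ l', x ∈ I) → l'.prod = w → l.length ≤ l'.length := by
  classical
  have hex : ∃ n, ∃ l : List W, (∀ x ∈ l, x ∈ I) ∧ l.prod = w ∧ l.length = n := by
    obtain ⟨l, h1, h2⟩ := list_of_mem_closure hI hw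
    exact ⟨_, l, h1, h2, rfl⟩
  obtain ⟨l, h1, h2, h3⟩ := Nat.find_spec hex
  refine ⟨l, h1, h2, fun l' h1' h2' => ?_⟩
  rw [h3]
  exact Nat.find_min' hex ⟨l', h1', h2', rfl⟩

noncomputable def twN (f : W →* Equiv.Perm (W × ZMod 2)) (w u : W) : ZMod 2 := (f w (u, 0)).2

namespace TwEX

variable {R : Set W} {f : W →* Equiv.Perm (W × ZMod 2)}

theorem inv_eq (h : TwEX R f) {r : W} (hr : r ∈ R) : r⁻¹ = r :=
  inv_eq_of_mul_eq_one_left (h.invol r hr)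

theorem top_mem (h : TwEX R f) (w : W) : w ∈ Subgroup.closure R := by
  rw [h.gen]; trivial

theorem formula (h : TwEX R f) (w u : W) (e : ZMod 2) :
    f w (u, e) = (w * u * w⁻¹, e + twN f w u) := by
  obtain ⟨l, hl, rfl⟩ := list_of_mem_closure h.invol (h.top_mem w)
  unfold twN
  induction l generalizing e with
  | nil => simp
  | cons r b ih =>
    have ih' := fun e => ih e (fun x hx => hl x (List.mem_cons_of_mem _ hx))
    have hr : r ∈ R := hl r (by simp)
    rw [List.prod_cons, map_mul, Equiv.Perm.mul_apply, Equiv.Perm.mul_apply, ih' e, ih' 0,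
      h.act r hr, twEta_apply, twEta_apply]
    ext
    · simp [mul_assoc]
    · simp [add_assoc]

theorem n_mul (h : TwEX R f) (v w u : W) :
    twN f (v * w) u = twN f w u + twN f v (w * u * w⁻¹) := by
  conv_lhs => unfold twN
  rw [map_mul, Equiv.Perm.mul_apply, h.formula w, h.formula v]
  simp

theorem n_one (u : W) : twN f 1 u = 0 := by simp [twN]

theorem n_gen (h : TwEX R f) {r : W} (hr : r ∈ R) (u : W) : twN f r u = twDel u r := by
  simp [twN, h.act r hr, twEta_apply]

theorem n_inv (h : TwEX R f) (w u : W) : twN f w⁻¹ (w * u * w⁻¹) = twN f w u := by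
  have := h.n_mul w⁻¹ w u
  rw [inv_mul_cancel, n_one] at this
  have h2 := z2_double (twN f w u)
  grind

theorem exch (h : TwEX R f) (l : List W) (hl : ∀ x ∈ l, x ∈ R) (u : W)
    (hu : twN f l.prod u = 1) : ∃ a r b, l = a ++ r :: b ∧ u = b.prod⁻¹ * r * b.prod := by
  induction l with
  | nil => simp [n_one] at hu
  | cons r b ih =>
    have hr : r ∈ R := hl r (by simp)
    rw [List.prod_cons, h.n_mul, h.n_gen hr, twDel_conj] at hu
    by_cases hc : u = b.prod⁻¹ * r * b.prod
    · exact ⟨[], r, b, rfl, hc⟩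
    · rw [twDel_ne hc, add_zero] at hu
      obtain ⟨a, r', b', e, e'⟩ := ih (fun x hx => hl x (List.mem_cons_of_mem _ hx)) hu
      exact ⟨r :: a, r', b', by rw [e]; rfl, e'⟩

/-- exchange: shorter word -/
theorem exch_del (h : TwEX R f) {I : Set W} (hI : I ⊆ R) (l : List W) (hl : ∀ x ∈ l, x ∈ I) (u : W)
    (hu : twN f l.prod u = 1) :
    ∃ l' : List W, (∀ x ∈ l', x ∈ I) ∧ l'.prod = l.prod * u ∧ l'.length < l.length := by
  obtain ⟨a, r, b, rfl, rfl⟩ := h.exch l (fun x hx => hI (hl x hx)) u hu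
  refine ⟨a ++ b, fun x hx => hl x ?_, ?_, by simp⟩
  · simp only [List.mem_append, List.mem_cons] at hx ⊢; tauto
  · have hr : r * r = 1 := h.invol r (hI (hl r (by simp)))
    simp only [List.prod_append, List.prod_cons]
    calc a.prod * b.prod = a.prod * (r * r) * b.prod := by rw [hr, mul_one]
      _ = _ := by group

/-- inversions are conjugates -/
theorem inv_conj (h : TwEX R f) {I : Set W} (hI : I ⊆ R) {w : W} (hw : w ∈ Subgroup.closure I)
    {u : W} (hu : twN f w u = 1) : ∃ b ∈ Subgroup.closure I, ∃ r ∈ I, u = b⁻¹ * r * b := by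
  obtain ⟨l, hl, rfl⟩ := list_of_mem_closure (fun r hr => h.invol r (hI hr)) hw
  obtain ⟨a, r, b, rfl, rfl⟩ := h.exch l (fun x hx => hI (hl x hx)) u hu
  refine ⟨b.prod, tw_list_prod_mem fun x hx => hl x ?_, r, hl r (by simp), rfl⟩
  simp [hx]

theorem inversion_mem (h : TwEX R f) {I : Set W} (hI : I ⊆ R) {w : W} (hw : w ∈ Subgroup.closure I)
    {u : W} (hu : twN f w u = 1) : u ∈ Subgroup.closure I := by
  obtain ⟨b, hb, r, hr, rfl⟩ := h.inv_conj hI hw hu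
  exact mul_mem (mul_mem (inv_mem hb) (Subgroup.subset_closure hr)) hb

theorem min_cons (h : TwEX R f) {I : Set W} (hI : I ⊆ R) (r : W) (b : List W)
    (hl : ∀ x ∈ r :: b, x ∈ I)
    (hmin : ∀ l' : List W, (∀ x ∈ l', x ∈ I) → l'.prod = (r :: b).prod →
      (r :: b).length ≤ l'.length) : twN f b.prod (b.prod⁻¹ * r * b.prod) = 0 := by
  rcases z2_cases (twN f b.prod (b.prod⁻¹ * r * b.prod)) with h0 | h1
  · exact h0
  · obtain ⟨l', h1, h2, h3⟩ := h.exch_del hI b (fun x hx => hl x (List.mem_cons_of_mem _ hx)) _ h1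
    have := hmin l' h1 (by rw [h2, List.prod_cons]; group)
    simp at this
    omega

theorem n_cons (h : TwEX R f) {r : W} (hr : r ∈ R) (b u : W) :
    twN f (r * b) u = twN f b u + twDel u (b⁻¹ * r * b) := by
  rw [h.n_mul, h.n_gen hr, twDel_conj]

theorem min_card (h : TwEX R f) {I : Set W} (hI : I ⊆ R) (l : List W) (hl : ∀ x ∈ l, x ∈ I)
    (hmin : ∀ l' : List W, (∀ x ∈ l', x ∈ I) → l'.prod = l.prod → l.length ≤ l'.length) :
    {u | twN f l.prod u = 1}.Finite ∧ {u | twN f l.prod u = 1}.ncard = l.length := by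
  induction l with
  | nil => simp [n_one]
  | cons r b ih =>
    have hb : ∀ x ∈ b, x ∈ I := fun x hx => hl x (List.mem_cons_of_mem _ hx)
    have hr : r ∈ I := hl r (by simp)
    have h0 := h.min_cons hI r b hl hmin
    obtain ⟨ih1, ih2⟩ := ih hb (by
      intro l' h1 h2
      have := hmin (r :: l') (by
        intro x hx
        rcases List.mem_cons.1 hx with rfl | hx
        · exact hr
        · exact h1 x hx) (by simp [h2])
      simpa using this)
    have hs : {u | twN f (r :: b).prod u = 1} =
        insert (b.prod⁻¹ * r * b.prod) {u | twN f b.prod u = 1} := by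
      ext u
      simp only [Set.mem_ofPred_eq, Set.mem_insert_iff, List.prod_cons, h.n_cons (hI hr)]
      by_cases hc : u = b.prod⁻¹ * r * b.prod
      · rw [hc, h0, twDel_self]; simp
      · rw [twDel_ne hc]; simp [hc]
    rw [hs]
    refine ⟨ih1.insert _, ?_⟩
    rw [Set.ncard_insert_of_notMem _ ih1, ih2, List.length_cons]
    simp [h0]

theorem length_eq (h : TwEX R f) (w : W) : wordLength R w = {u | twN f w u = 1}.ncard := by
  obtain ⟨l, hl, rfl, hmin⟩ := exists_min_list h.invol (h.top_mem w)
  rw [(h.min_card subset_rfl l hl hmin).2]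
  apply le_antisymm
  · exact Nat.sInf_le ⟨l, hl, rfl, rfl⟩
  · refine le_csInf (s := {n | ∃ l' : List W, (∀ x ∈ l', x ∈ R) ∧ l'.length = n ∧ l'.prod = l.prod})
      ⟨_, l, hl, rfl, rfl⟩ ?_
    rintro n ⟨l', h1, rfl, h2⟩
    exact hmin l' h1 h2

theorem length_lt (h : TwEX R f) {w u : W} (hu : twN f w u = 1) :
    wordLength R (w * u) < wordLength R w := by
  obtain ⟨l, hl, rfl, hmin⟩ := exists_min_list h.invol (h.top_mem w)
  rw [h.length_eq l.prod, (h.min_card subset_rfl l hl hmin).2]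
  obtain ⟨l', h1, h2, h3⟩ := h.exch_del subset_rfl l hl u hu
  exact (Nat.sInf_le ⟨l', h1, rfl, h2⟩ : wordLength R _ ≤ _).trans_lt h3

theorem length_inv (h : TwEX R f) (w : W) : wordLength R w⁻¹ = wordLength R w := by
  rw [h.length_eq, h.length_eq]
  refine Set.ncard_congr (fun u _ => w⁻¹ * u * w) ?_ ?_ ?_
  · intro u hu
    have := h.n_inv w (w⁻¹ * u * w)
    simp only [Set.mem_ofPred_eq] at hu ⊢
    rw [← this, ← hu]; congr 1; group
  · intro a b _ _ hab
    simpa using hab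
  · intro u hu
    exact ⟨w * u * w⁻¹, by rw [Set.mem_ofPred_eq, h.n_inv]; exact hu, by group⟩

/-- if the only inversion is one element, and `t ∈ ⟨I⟩`, then `t ∈ I` -/
theorem mem_of_single (h : TwEX R f) {I : Set W} (hI : I ⊆ R) {t : W}
    (ht : t ∈ Subgroup.closure I) (hn : ∀ u, twN f t u = twDel u t) : t ∈ I := by
  obtain ⟨l, hl, hp, hmin⟩ := exists_min_list (fun r hr => h.invol r (hI hr)) ht
  subst hp
  have h1 := (h.min_card hI l hl hmin).2
  have : {u | twN f l.prod u = 1} = {l.prod} := by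
    ext u
    simp only [Set.mem_ofPred_eq, hn, Set.mem_singleton_iff]
    by_cases hc : u = l.prod
    · simp [hc, twDel_self]
    · simp [hc, twDel_ne hc]
  rw [this, Set.ncard_singleton] at h1
  obtain ⟨a, rfl⟩ := List.length_eq_one_iff.1 h1.symm
  simpa using hl

theorem mem_parabolic (h : TwEX R f) {I : Set W} (hI : I ⊆ R) {r : W} (hr : r ∈ R)
    (hrI : r ∈ Subgroup.closure I) : r ∈ I :=
  h.mem_of_single hI hrI fun u => h.n_gen hr u

theorem ne_one (h : TwEX R f) {r : W} (hr : r ∈ R) : r ≠ 1 := by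
  rintro rfl
  have := h.n_gen hr 1
  rw [n_one, twDel_self] at this
  exact absurd this (by decide)

theorem inter_trivial (h : TwEX R f) {I I' : Set W} (hI : I ⊆ R) (hI' : I' ⊆ R)
    (hd : ∀ x ∈ I, x ∉ I') {w : W} (hw : w ∈ Subgroup.closure I) (hw' : w ∈ Subgroup.closure I') :
    w = 1 := by
  obtain ⟨l, hl, rfl, hmin⟩ := exists_min_list (fun r hr => h.invol r (hI hr)) hw
  cases l with
  | nil => rfl
  | cons r b =>
    exfalso
    have hr : r ∈ I := hl r (by simp)
    have h0 := h.min_cons hI r b hl hmin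
    have h1 : twN f (r :: b).prod (b.prod⁻¹ * r * b.prod) = 1 := by
      rw [List.prod_cons, h.n_cons (hI hr), h0, twDel_self, zero_add]
    have h2 := h.inversion_mem hI' hw' h1
    have h3 : r = (r :: b).prod * (b.prod⁻¹ * r * b.prod) * ((r :: b).prod)⁻¹ := by
      rw [List.prod_cons]; group
    refine hd r hr (h.mem_parabolic hI' (hI hr) ?_)
    rw [h3]
    exact mul_mem (mul_mem hw' h2) (inv_mem hw')

theorem longest_inv (h : TwEX R f) {J : Set W} {ρ : W} (hρ : IsLongestIn R J ρ) :
    IsLongestIn R J ρ⁻¹ :=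
  ⟨inv_mem hρ.1, fun x hx => by rw [h.length_inv]; exact hρ.2 x hx⟩

theorem longest_conj (h : TwEX R f) {J : Set W} (hJ : J ⊆ R) {ρ : W} (hρ : IsLongestIn R J ρ)
    {j : W} (hj : j ∈ J) : ρ * j * ρ⁻¹ ∈ J := by
  have key : ∀ b ∈ Subgroup.closure J, ∀ r ∈ J, twN f ρ (b⁻¹ * r * b) = 1 := by
    intro b hb r hr
    rcases z2_cases (twN f ρ (b⁻¹ * r * b)) with h0 | h1
    · exfalso
      have hx1 : twN f (b⁻¹ * r * b) (b⁻¹ * r * b) = 1 := by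
        have e1 := h.n_inv b (b⁻¹ * r * b)
        have e2 : b * (b⁻¹ * r * b) * b⁻¹ = r := by group
        have e3 : r * r * r⁻¹ = r := by group
        rw [e2] at e1
        rw [h.n_mul, e2, h.n_mul, h.n_gen (hJ hr), e3, e1, twDel_self]
        have := z2_double (twN f b (b⁻¹ * r * b))
        grind
      have hxx : (b⁻¹ * r * b) * (b⁻¹ * r * b) = 1 := by
        have : (b⁻¹ * r * b) * (b⁻¹ * r * b) = b⁻¹ * (r * r) * b := by group
        rw [this, h.invol r (hJ hr)]; group
      have hxm : b⁻¹ * r * b ∈ Subgroup.closure J :=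
        mul_mem (mul_mem (inv_mem hb) (Subgroup.subset_closure hr)) hb
      generalize b⁻¹ * r * b = x at *
      have h2 : twN f (ρ * x) x = 1 := by
        rw [h.n_mul, hx1, mul_inv_cancel_right, h0, add_zero]
      have h3 := h.length_lt h2
      rw [mul_assoc, hxx, mul_one] at h3
      exact absurd (hρ.2 (ρ * x) (mul_mem hρ.1 hxm)) (not_le.2 h3)
    · exact h1
  have hji : j⁻¹ = j := h.inv_eq (hJ hj)
  have hjm : j ∈ Subgroup.closure J := Subgroup.subset_closure hj
  have one_dir : ∀ v, twN f ρ v = 1 → twN f ρ (j * v * j⁻¹) = 1 := by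
    intro v hv
    obtain ⟨b, hb, r, hr, rfl⟩ := h.inv_conj hJ hρ.1 hv
    have : j * (b⁻¹ * r * b) * j⁻¹ = (b * j⁻¹)⁻¹ * r * (b * j⁻¹) := by group
    rw [this]
    exact key _ (mul_mem hb (inv_mem hjm)) r hr
  have both : ∀ v, twN f ρ (j * v * j⁻¹) = twN f ρ v := by
    intro v
    rcases z2_cases (twN f ρ v) with h0 | h1
    · rcases z2_cases (twN f ρ (j * v * j⁻¹)) with h0' | h1'
      · rw [h0, h0']
      · have := one_dir _ h1'
        have e : j * (j * v * j⁻¹) * j⁻¹ = v := by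
          have : j * (j * v * j⁻¹) * j⁻¹ = (j * j) * v * (j * j)⁻¹ := by group
          rw [this, h.invol j (hJ hj)]; group
        rw [e, h0] at this
        exact absurd this (by decide)
    · rw [h1, one_dir v h1]
  refine h.mem_of_single hJ (mul_mem (mul_mem hρ.1 hjm) (inv_mem hρ.1)) fun u => ?_
  obtain ⟨v, rfl⟩ : ∃ v, u = ρ * v * ρ⁻¹ := ⟨ρ⁻¹ * u * ρ, by group⟩
  have e1 : ρ⁻¹ * (ρ * v * ρ⁻¹) * ρ⁻¹⁻¹ = v := by group
  rw [h.n_mul, h.n_inv, e1, h.n_mul, h.n_gen (hJ hj), both, twDel_conj]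
  have e2 : ρ⁻¹ * (ρ * j * ρ⁻¹) * ρ = j := by group
  rw [e2]
  have := z2_double (twN f ρ v)
  grind

end TwEX

/-- gluing homomorphisms along an admissible pair -/
theorem glue_hom {R J K : Set W} (hR : IsCoxeterGenSet R) (hadm : IsAdmissiblePair R J K)
    {G : Type*} [Group G] (φ ψ : W →* G) (hag : ∀ r ∈ J ∪ perpSet R J, φ r = ψ r) :
    ∃ χ : W →* G, (∀ r ∈ J ∪ perpSet R J ∪ K, χ r = φ r) ∧
      (∀ r ∈ R \ (J ∪ perpSet R J ∪ K), χ r = ψ r) := by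
  classical
  obtain ⟨M, cs, hcs⟩ := hR
  obtain ⟨hJ, hK, -, -, hord⟩ := hadm
  let g : R → G := fun r => if (r : W) ∈ J ∪ perpSet R J ∪ K then φ r else ψ r
  have hpow : ∀ i j : R, ((i : W) * (j : W)) ^ M i j = 1 := by
    intro i j
    have := cs.simple_mul_simple_pow i j
    rwa [hcs, hcs] at this
  have hl : M.IsLiftable g := by
    intro i j
    by_cases hi : (i : W) ∈ J ∪ perpSet R J ∪ K <;> by_cases hj : (j : W) ∈ J ∪ perpSet R J ∪ K
    · simp only [g, hi, hj, if_true]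
      rw [← map_mul, ← map_pow, hpow, map_one]
    · simp only [g, hi, hj, if_true, if_false]
      rcases hi with hi | hi
      · rw [hag _ hi, ← map_mul, ← map_pow, hpow, map_one]
      · have h0 := hord i hi j ⟨j.2, hj⟩
        have : M i j = 0 := by
          by_contra hne
          exact (orderOf_eq_zero_iff'.1 h0) _ (Nat.pos_of_ne_zero hne) (hpow i j)
        rw [this, pow_zero]
    · simp only [g, hi, hj, if_true, if_false]
      rcases hj with hj | hj
      · rw [hag _ hj, ← map_mul, ← map_pow, hpow, map_one]
      · have h0 := hord j hj i ⟨i.2, hi⟩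
        have : M i j = 0 := by
          by_contra hne
          rw [M.symmetric] at hne
          exact (orderOf_eq_zero_iff'.1 h0) _ (Nat.pos_of_ne_zero hne) (hpow j i)
        rw [this, pow_zero]
    · simp only [g, hi, hj, if_false]
      rw [← map_mul, ← map_pow, hpow, map_one]
  have hap : ∀ r (hr : r ∈ R), cs.lift ⟨g, hl⟩ r = g ⟨r, hr⟩ := by
    intro r hr
    have := cs.lift_apply_simple hl ⟨r, hr⟩
    rwa [hcs] at this
  refine ⟨cs.lift ⟨g, hl⟩, ?_, ?_⟩
  · intro r hr
    have hrR : r ∈ R := by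
      rcases hr with (hr | hr) | hr
      · exact hJ hr
      · exact hr.1
      · exact hK hr
    rw [hap r hrR]
    exact if_pos hr
  · intro r hr
    rw [hap r hr.1]
    simp only [g, if_neg hr.2]

/-- the data shared by the remaining arguments -/
theorem perp_comm {R J : Set W} {f : W →* Equiv.Perm (W × ZMod 2)} (h : TwEX R f) (hJ : J ⊆ R)
    {k : W} (hk : k ∈ perpSet R J) {w : W} (hw : w ∈ Subgroup.closure J) : w * k = k * w := by
  induction hw using Subgroup.closure_induction with
  | mem j hj =>
    have h2 : (k * j) * (k * j) = 1 := by rw [← pow_two, ← hk.2 j hj, pow_orderOf_eq_one]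
    have h3 : (k * j)⁻¹ = k * j := inv_eq_of_mul_eq_one_left h2
    rwa [mul_inv_rev, h.inv_eq hk.1, h.inv_eq (hJ hj)] at h3
  | one => simp
  | mul x y _ _ hx hy => rw [mul_assoc, hy, ← mul_assoc, hx, mul_assoc]
  | inv x _ hx =>
    have hx' : Commute x k := hx
    exact hx'.inv_left

def twC (ρ : W) : Equiv.Perm (W × ZMod 2) where
  toFun x := (ρ * x.1 * ρ⁻¹, x.2)
  invFun x := (ρ⁻¹ * x.1 * ρ, x.2)
  left_inv x := by ext <;> simp [mul_assoc]
  right_inv x := by ext <;> simp [mul_assoc]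

theorem twC_conj (ρ l : W) : twC ρ * twEta l = twEta (ρ * l * ρ⁻¹) * twC ρ := by
  ext1 x
  obtain ⟨u, e⟩ := x
  show twC ρ (twEta l (u, e)) = twEta (ρ * l * ρ⁻¹) (ρ * u * ρ⁻¹, e)
  rw [twEta_apply, twEta_apply, twDel_conj]
  have e2 : ρ⁻¹ * (ρ * l * ρ⁻¹) * ρ = l := by group
  rw [e2]
  refine Prod.ext ?_ rfl
  show ρ * (l * u * l⁻¹) * ρ⁻¹ = _
  group

theorem hom_eq_on_closure {G : Type*} [Group G] {J : Set W} (φ ψ : W →* G)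
    (h : ∀ j ∈ J, φ j = ψ j) {w : W} (hw : w ∈ Subgroup.closure J) : φ w = ψ w := by
  have : Set.EqOn φ ψ (Subgroup.closure J) := MonoidHom.eqOn_closure (f := φ) (g := ψ) (fun j hj => h j hj)
  exact this hw

theorem base_conj {R J : Set W} {ρ : W} {f : W →* Equiv.Perm (W × ZMod 2)} (h : TwEX R f)
    (hJ : J ⊆ R) (hρ : IsLongestIn R J ρ) {r : W} (hr : r ∈ J ∪ perpSet R J) :
    ρ * r * ρ⁻¹ ∈ J ∪ perpSet R J := by
  rcases hr with hr | hr
  · exact Or.inl (h.longest_conj hJ hρ hr)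
  · right
    rw [perp_comm h hJ hr hρ.1, mul_inv_cancel_right]; exact hr

/-- `R'` also satisfies the exchange condition, with the same cocycle on `⟨J⟩`. -/
theorem twEX_twist {R J K : Set W} {ρ : W} {f : W →* Equiv.Perm (W × ZMod 2)}
    (hR : IsCoxeterGenSet R) (h : TwEX R f)
    (hadm : IsAdmissiblePair R J K) (hρ : IsLongestIn R J ρ) :
    ∃ f', TwEX (twistSet R J K ρ) f' ∧ ∀ w ∈ Subgroup.closure J, f' w = f w := by
  have hJ := hadm.1
  have hK := hadm.2.1
  have hbase : J ∪ perpSet R J ⊆ R := Set.union_subset hJ (fun x hx => hx.1)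
  let A : Equiv.Perm (W × ZMod 2) := (f ρ)⁻¹ * twC ρ
  have hA : ∀ l ∈ R, A * f l * A⁻¹ = (f ρ)⁻¹ * twEta (ρ * l * ρ⁻¹) * f ρ := by
    intro l hl
    simp only [A]
    rw [h.act l hl, mul_assoc _ (twC ρ), twC_conj]
    group
  obtain ⟨χ, h1, h2⟩ := glue_hom hR hadm f ((MulAut.conj A).toMonoidHom.comp f) (by
    intro r hr
    show f r = A * f r * A⁻¹
    rw [hA r (hbase hr), ← h.act _ (hbase (base_conj h hJ hρ hr)), ← map_inv, ← map_mul, ← map_mul]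
    congr 1; group)
  have hJeq : ∀ w ∈ Subgroup.closure J, χ w = f w := fun w hw =>
    hom_eq_on_closure χ f (fun j hj => h1 j (Or.inl (Or.inl hj))) hw
  refine ⟨χ, ⟨?_, ?_, ?_⟩, hJeq⟩
  · rintro r (((hr | hr) | hr) | ⟨l, hl, rfl⟩)
    · exact h.invol r (hJ hr)
    · exact h.invol r hr.1
    · exact h.invol r (hK hr)
    · have : (ρ * l * ρ⁻¹) * (ρ * l * ρ⁻¹) = ρ * (l * l) * ρ⁻¹ := by group
      show (ρ * l * ρ⁻¹) * (ρ * l * ρ⁻¹) = 1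
      rw [this, h.invol l hl.1]; group
  · rw [eq_top_iff, ← h.gen, Subgroup.closure_le]
    intro r hr
    by_cases hc : r ∈ J ∪ perpSet R J ∪ K
    · exact Subgroup.subset_closure (Or.inl hc)
    · have hm : ρ ∈ Subgroup.closure (twistSet R J K ρ) :=
        Subgroup.closure_mono (fun x hx => Or.inl (Or.inl (Or.inl hx))) hρ.1
      have hm2 : ρ * r * ρ⁻¹ ∈ Subgroup.closure (twistSet R J K ρ) :=
        Subgroup.subset_closure (Or.inr ⟨r, ⟨hr, hc⟩, rfl⟩)
      have : r = ρ⁻¹ * (ρ * r * ρ⁻¹) * ρ := by group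
      rw [this]
      exact mul_mem (mul_mem (inv_mem hm) hm2) hm
  · rintro r (hr | ⟨l, hl, rfl⟩)
    · rw [h1 r hr, h.act]
      rcases hr with (hr | hr) | hr
      · exact hJ hr
      · exact hr.1
      · exact hK hr
    · show χ (ρ * l * ρ⁻¹) = twEta (ρ * l * ρ⁻¹)
      rw [map_mul, map_mul, h2 l hl, map_inv, hJeq ρ hρ.1]
      show f ρ * (A * f l * A⁻¹) * (f ρ)⁻¹ = _
      rw [hA l hl.1]
      group

theorem conj_notMem {R J K : Set W} {ρ : W} {f : W →* Equiv.Perm (W × ZMod 2)}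
    (h : TwEX R f) (hadm : IsAdmissiblePair R J K) (hρ : IsLongestIn R J ρ)
    {l : W} (hl : l ∈ R \ (J ∪ perpSet R J ∪ K)) : ρ * l * ρ⁻¹ ∉ J ∪ perpSet R J ∪ K := by
  have hJ := hadm.1
  have e : l = ρ⁻¹ * (ρ * l * ρ⁻¹) * ρ⁻¹⁻¹ := by group
  rintro (hc | hc)
  · have := base_conj h hJ (h.longest_inv hρ) hc
    rw [← e] at this
    exact hl.2 (Or.inl this)
  · have hsub : insert (ρ * l * ρ⁻¹) J ⊆ R := Set.insert_subset (hadm.2.1 hc) hJ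
    have hm : ρ ∈ Subgroup.closure (insert (ρ * l * ρ⁻¹) J) :=
      Subgroup.closure_mono (Set.subset_insert _ _) hρ.1
    have : l ∈ insert (ρ * l * ρ⁻¹) J := by
      apply h.mem_parabolic hsub hl.1
      have hx : ρ * l * ρ⁻¹ ∈ Subgroup.closure (insert (ρ * l * ρ⁻¹) J) :=
        Subgroup.subset_closure (Set.mem_insert _ _)
      have := mul_mem (mul_mem (inv_mem hm) hx) (inv_mem (inv_mem hm))
      rwa [← e] at this
    rcases this with h1 | h1
    · exact hl.2 (Or.inr (h1 ▸ hc))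
    · exact hl.2 (Or.inl (Or.inl h1))

/-- left translation action on `W × ℤ` -/
def twLam : W →* Equiv.Perm (W × ℤ) where
  toFun w :=
    { toFun := fun x => (w * x.1, x.2)
      invFun := fun x => (w⁻¹ * x.1, x.2)
      left_inv := fun x => by simp
      right_inv := fun x => by simp }
  map_one' := by ext1 x; simp
  map_mul' a b := by ext1 x; simp [mul_assoc]

theorem twLam_apply (w : W) (x : W × ℤ) : twLam w x = (w * x.1, x.2) := rfl

noncomputable def twInd (H : Subgroup W) (w : W) : ℤ := open Classical in if w ∈ H then 1 else 0

noncomputable def twP (H : Subgroup W) : Equiv.Perm (W × ℤ) where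
  toFun x := (x.1, x.2 + twInd H x.1)
  invFun x := (x.1, x.2 - twInd H x.1)
  left_inv x := by simp
  right_inv x := by simp

theorem twP_conj (H : Subgroup W) (w : W) (x : W × ℤ) :
    (twP H * twLam w * (twP H)⁻¹) x = (w * x.1, x.2 - twInd H x.1 + twInd H (w * x.1)) := rfl

theorem infinite_order {R J K : Set W} {ρ : W} {f : W →* Equiv.Perm (W × ZMod 2)}
    (hR : IsCoxeterGenSet R) (h : TwEX R f)
    (hadm : IsAdmissiblePair R J K) (hρ : IsLongestIn R J ρ) {k l : W} (hk : k ∈ K)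
    (hl : l ∈ R \ (J ∪ perpSet R J ∪ K)) : orderOf (k * (ρ * l * ρ⁻¹)) = 0 := by
  have hJ := hadm.1
  obtain ⟨f', h', -⟩ := twEX_twist hR h hadm hρ
  have hnot := conj_notMem h hadm hρ hl
  have hlR' : ρ * l * ρ⁻¹ ∈ twistSet R J K ρ := Or.inr ⟨l, hl, rfl⟩
  have hkR' : k ∈ twistSet R J K ρ := Or.inl (Or.inr hk)
  have hknot : k ∉ J ∪ perpSet R J := fun hc => by
    have : k ∈ K ∩ (J ∪ perpSet R J) := ⟨hk, hc⟩
    rw [hadm.2.2.2.1] at this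
    exact this
  let H : Subgroup W := Subgroup.closure (J ∪ perpSet R J)
  have hρH : ρ ∈ H := Subgroup.closure_mono Set.subset_union_left hρ.1
  have hcomm : ∀ w ∈ H, twP H * twLam w * (twP H)⁻¹ = twLam w := by
    intro w hw
    ext1 x
    rw [twP_conj, twLam_apply]
    have : twInd H (w * x.1) = twInd H x.1 := by
      have hiff : w * x.1 ∈ H ↔ x.1 ∈ H := Subgroup.mul_mem_cancel_left H hw
      unfold twInd
      by_cases hc : x.1 ∈ H
      · rw [if_pos hc, if_pos (hiff.2 hc)]
      · rw [if_neg hc, if_neg (fun hh => hc (hiff.1 hh))]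
    rw [this]
    simp
  obtain ⟨χ, h1, h2⟩ := glue_hom hR hadm twLam ((MulAut.conj (twP H)).toMonoidHom.comp twLam) (by
    intro r hr
    exact (hcomm r (Subgroup.subset_closure hr)).symm)
  have hχρ : χ ρ = twLam ρ :=
    hom_eq_on_closure χ twLam (fun j hj => h1 j (Or.inl (Or.inl hj))) hρ.1
  have hχl : χ (ρ * l * ρ⁻¹) = twP H * twLam (ρ * l * ρ⁻¹) * (twP H)⁻¹ := by
    rw [map_mul, map_mul, h2 l hl, map_inv, hχρ]
    show twLam ρ * (twP H * twLam l * (twP H)⁻¹) * (twLam ρ)⁻¹ = _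
    rw [← hcomm ρ hρH, map_mul, map_mul, map_inv]
    group
  have hχk : χ k = twLam k := h1 k (Or.inr hk)
  generalize ρ * l * ρ⁻¹ = t at *
  have htt := h'.invol t hlR'
  have hkk := h'.invol k hkR'
  have ht1 := h'.ne_one hlR'
  have hk1 := h'.ne_one hkR'
  have hD : ∀ w ∈ Subgroup.closure {k, t}, w ∈ H → w = 1 := by
    intro w hw hw'
    refine h'.inter_trivial ?_ ?_ ?_ hw hw'
    · rintro x (rfl | rfl)
      · exact hkR'
      · exact hlR'
    · intro x hx; exact Or.inl (Or.inl hx)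
    · rintro x (rfl | rfl)
      · exact hknot
      · exact fun hc => hnot (Or.inl hc)
  have hkD : k ∈ Subgroup.closure {k, t} := Subgroup.subset_closure (by simp)
  have htD : t ∈ Subgroup.closure {k, t} := Subgroup.subset_closure (by simp)
  have hpD : ∀ i : ℕ, (k * t) ^ i ∈ Subgroup.closure {k, t} :=
    fun i => pow_mem (mul_mem hkD htD) i
  have hnt : ∀ i : ℕ, t * (k * t) ^ i ≠ 1 := by
    intro i hi
    have hit : (k * t) ^ i = t := by
      have : t * (k * t) ^ i = t * t := by rw [hi, htt]
      exact mul_left_cancel this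
    have hc : Commute (k * t) t := by
      have := (Commute.refl (k * t)).pow_right i
      rwa [hit] at this
    have hc2 : k * t * t = t * (k * t) := hc
    rw [mul_assoc, htt, mul_one] at hc2
    have hsq : (k * t) ^ 2 = 1 := by
      rw [pow_two, mul_assoc, ← hc2, hkk]
    rcases Nat.even_or_odd' i with ⟨c, rfl | rfl⟩
    · rw [pow_mul, hsq, one_pow] at hit
      exact ht1 hit.symm
    · rw [pow_succ, pow_mul, hsq, one_pow, one_mul] at hit
      exact hk1 (mul_eq_right.1 hit)
  have hstep : ∀ i : ℕ, ∃ c : ℤ, χ ((k * t) ^ i) (1, 0) = ((k * t) ^ i, c) ∧ c ≤ 0 ∧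
      (1 ≤ i → c ≤ -1) := by
    intro i
    induction i with
    | zero => exact ⟨0, by simp, le_rfl, by simp⟩
    | succ i ih =>
      obtain ⟨c, hc, hc0, hc1⟩ := ih
      refine ⟨c - twInd H ((k * t) ^ i) + twInd H (t * (k * t) ^ i), ?_, ?_⟩
      · rw [pow_succ', map_mul, Equiv.Perm.mul_apply, hc, map_mul, Equiv.Perm.mul_apply, hχl,
          twP_conj, hχk, twLam_apply]
        simp [mul_assoc]
      · have e1 : twInd H (t * (k * t) ^ i) = 0 := by
          unfold twInd
          rw [if_neg]
          exact fun hm => hnt i (hD _ (mul_mem htD (hpD i)) hm)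
        have e2 : 0 ≤ twInd H ((k * t) ^ i) := by
          unfold twInd; split_ifs <;> norm_num
        rw [e1]
        rcases Nat.eq_zero_or_pos i with rfl | hi
        · have e3 : twInd H ((k * t) ^ 0) = 1 := by
            unfold twInd; rw [if_pos]; rw [pow_zero]; exact one_mem H
          rw [e3]
          exact ⟨by omega, fun _ => by omega⟩
        · have := hc1 hi
          exact ⟨by omega, fun _ => by omega⟩
  rw [orderOf_eq_zero_iff']
  intro n hn hpow
  obtain ⟨c, hc, -, hc1⟩ := hstep n
  rw [hpow, map_one, Equiv.Perm.one_apply] at hc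
  have hc2 : (0 : ℤ) = c := congrArg Prod.snd hc
  have := hc1 hn
  omega

theorem perp_twist {R J K : Set W} {ρ : W} {f : W →* Equiv.Perm (W × ZMod 2)}
    (h : TwEX R f) (hadm : IsAdmissiblePair R J K) (hρ : IsLongestIn R J ρ) :
    perpSet (twistSet R J K ρ) J = perpSet R J := by
  ext k
  constructor
  · rintro ⟨hk | ⟨l, hl, rfl⟩, hk2⟩
    · refine ⟨?_, hk2⟩
      rcases hk with (hr | hr) | hr
      · exact hadm.1 hr
      · exact hr.1
      · exact hadm.2.1 hr
    · exfalso
      refine hl.2 (Or.inl (Or.inr ⟨hl.1, fun j hj => ?_⟩))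
      have h1 := hk2 _ (h.longest_conj hadm.1 hρ hj)
      have e : (ρ * l * ρ⁻¹) * (ρ * j * ρ⁻¹) = MulAut.conj ρ (l * j) := by
        rw [MulAut.conj_apply]; group
      rw [← h1]
      show _ = orderOf ((ρ * l * ρ⁻¹) * (ρ * j * ρ⁻¹))
      rw [e]
      exact (orderOf_injective (MulAut.conj ρ).toMonoidHom (MulAut.conj ρ).injective (l * j)).symm
  · intro hk
    exact ⟨Or.inl (Or.inl (Or.inr hk)), hk.2⟩

theorem twist_symm_aux {R R' : Set W} (hR : IsCoxeterGenSet R) (ht : IsTwistOf R' R) :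
    IsTwistOf R R' := by
  obtain ⟨J, K, ρ, hadm, hρ, rfl⟩ := ht
  obtain ⟨f, h⟩ := twEX_of_coxeter hR
  obtain ⟨f', h', hff⟩ := twEX_twist hR h hadm hρ
  have hperp := perp_twist h hadm hρ
  have hL : twistSet R J K ρ \ (J ∪ perpSet R J ∪ K) =
      (fun l => ρ * l * ρ⁻¹) '' (R \ (J ∪ perpSet R J ∪ K)) := by
    ext x
    constructor
    · rintro ⟨hx | hx, hx2⟩
      · exact absurd hx hx2
      · exact hx
    · rintro ⟨l, hl, rfl⟩
      exact ⟨Or.inr ⟨l, hl, rfl⟩, conj_notMem h hadm hρ hl⟩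
  have hlen : ∀ x ∈ Subgroup.closure J, wordLength (twistSet R J K ρ) x = wordLength R x := by
    intro x hx
    rw [h'.length_eq, h.length_eq]
    unfold twN
    rw [hff x hx]
  refine ⟨J, K, ρ⁻¹, ⟨fun x hx => Or.inl (Or.inl (Or.inl hx)), fun x hx => Or.inl (Or.inr hx),
    hadm.2.2.1, ?_, ?_⟩, ⟨inv_mem hρ.1, fun x hx => ?_⟩, ?_⟩
  · rw [hperp]; exact hadm.2.2.2.1
  · intro k hk x hx
    rw [hperp, hL] at hx
    obtain ⟨l, hl, rfl⟩ := hx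
    exact infinite_order hR h hadm hρ hk hl
  · rw [hlen x hx, hlen _ (inv_mem hρ.1)]
    exact (h.longest_inv hρ).2 x hx
  · show R = J ∪ perpSet (twistSet R J K ρ) J ∪ K ∪ (fun l => ρ⁻¹ * l * ρ⁻¹⁻¹) ''
      (twistSet R J K ρ \ (J ∪ perpSet (twistSet R J K ρ) J ∪ K))
    rw [hperp, hL, Set.image_image]
    have : (fun l => ρ⁻¹ * (ρ * l * ρ⁻¹) * ρ⁻¹⁻¹) = (id : W → W) := by
      funext l; simp only [id]; group
    rw [this, Set.image_id, Set.union_diff_self, Set.union_eq_self_of_subset_left]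
    rintro r ((hr | hr) | hr)
    · exact hadm.1 hr
    · exact hr.1
    · exact hadm.2.1 hr

theorem conj_twist {R R' : Set W} (ht : IsTwistOf R' R) : R' ⊆ conjSet R := by
  obtain ⟨J, K, ρ, hadm, hρ, rfl⟩ := ht
  rintro r (hr | ⟨l, hl, rfl⟩)
  · refine ⟨1, r, ?_, by simp⟩
    rcases hr with (hr | hr) | hr
    · exact hadm.1 hr
    · exact hr.1
    · exact hadm.2.1 hr
  · exact ⟨ρ, l, hl.1, rfl⟩

theorem conjSet_sub {A B : Set W} (h : A ⊆ conjSet B) : conjSet A ⊆ conjSet B := by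
  rintro x ⟨w, a, ha, rfl⟩
  obtain ⟨v, b, hb, rfl⟩ := h ha
  exact ⟨w * v, b, hb, by group⟩

/-- Let `(W, S)` be a Coxeter system and `R ⊆ S^W` a Coxeter generating set.
If `R'` is a twist of `R`, then `R ⊆ (R')^W`, `(R')^W = R^W`, and twisting is symmetric:
`R` is a twist of `R'`. -/
theorem coxeter_twist_symmetric
    {B : Type*} {M : CoxeterMatrix B} (cs : CoxeterSystem M W)
    (R : Set W) (hRgen : IsCoxeterGenSet R)
    (hRrefl : ∀ r ∈ R, ∃ (w : W) (i : B), r = w * cs.simple i * w⁻¹)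
    (R' : Set W) (h : IsTwistOf R' R) :
    R ⊆ conjSet R' ∧ conjSet R' = conjSet R ∧ IsTwistOf R R' := by
  have hs := twist_symm_aux hRgen h
  exact ⟨conj_twist hs, (conjSet_sub (conj_twist h)).antisymm (conjSet_sub (conj_twist hs)), hs⟩

end
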